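/- arXiv:2507.01027 — 4 statements merged into one kernel-verified Lean document; each statement's English description precedes it below -/
import Mathlib

section
/- Under the part-1 setup, let m > 1 be a real number with m·b_j ≤ A/n for every j, let x ∈ ℝⁿ be the constant vector with every entry 2, let x_new ∈ ℝⁿ have entries 2 at positions i ≤ k and 2/m at positions i > k, and let w_new ∈ ℝⁿ have first k entries a_1, …, a_k and last n−k entries m·b_1, …, m·b_{n−k}. Then the gain in quantized output from scaling up the small entries equals ⟨x_new, deq(w_new)⟩ − ⟨x, deq(w)⟩ = 2(1 − 1/m)(n−k)(n−2k)A/n², which is strictly positive. -/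
open Finset

/-- Binarization shift: `β(w) = (1/n)·Σ_i w_i`. -/
noncomputable def bShift {n : ℕ} (w : Fin n → ℝ) : ℝ :=
  (1 / (n : ℝ)) * ∑ i, w i

/-- Binarization scale: `α(w) = (1/n)·Σ_i |w_i − β(w)|`. -/
noncomputable def bScale {n : ℕ} (w : Fin n → ℝ) : ℝ :=
  (1 / (n : ℝ)) * ∑ i, |w i - bShift w|

/-- Sign function: `+1` if `t > 0`, `−1` if `t ≤ 0`. -/
noncomputable def bSign (t : ℝ) : ℝ :=
  if t > 0 then 1 else -1

/-- Dequantized vector: `deq(w)_i = α(w)·Sign(w_i − β(w)) + β(w)`. -/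
noncomputable def bDeq {n : ℕ} (w : Fin n → ℝ) : Fin n → ℝ :=
  fun i => bScale w * bSign (w i - bShift w) + bShift w

theorem sum_fin_eq_head_add_tail {n k : ℕ} (hkn : k ≤ n) (f : Fin n → ℝ) :
    ∑ i, f i = ∑ i : Fin k, f ⟨i, by omega⟩ + ∑ j : Fin (n - k), f ⟨k + j, by omega⟩ := by
  rw [← (finCongr (Nat.add_sub_cancel' hkn)).sum_comp f, Fin.sum_univ_add]
  rfl

/-- A weighted sum of the dequantization of a vector whose first `k` entries sum to `A` and exceed
the mean `A / n`, and whose other entries sum to zero and do not exceed it. -/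
theorem sum_mul_bDeq {n k : ℕ} (hn : 0 < n) (hkn : k ≤ n) {A : ℝ}
    (a : Fin k → ℝ) (hasum : ∑ i, a i = A) (halarge : ∀ i, A / n < a i)
    (b : Fin (n - k) → ℝ) (hbsum : ∑ j, b j = 0) (hbsmall : ∀ j, b j ≤ A / n)
    (w : Fin n → ℝ)
    (hw1 : ∀ i : Fin k, w ⟨i, by omega⟩ = a i)
    (hw2 : ∀ j : Fin (n - k), w ⟨k + j, by omega⟩ = b j)
    (x : Fin n → ℝ) {c d : ℝ}
    (hx1 : ∀ i : Fin n, (i : ℕ) < k → x i = c)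
    (hx2 : ∀ i : Fin n, k ≤ (i : ℕ) → x i = d) :
    ∑ i, x i * bDeq w i =
      k * (c * (2 * ((n : ℝ) - k) * A / n ^ 2 + A / n)) +
        ((n : ℝ) - k) * (d * (A / n - 2 * ((n : ℝ) - k) * A / n ^ 2)) := by
  have hn0 : (n : ℝ) ≠ 0 := by positivity
  have hshift : bShift w = A / n := by
    rw [bShift, sum_fin_eq_head_add_tail hkn]
    simp only [hw1, hw2, hasum, hbsum]
    ring
  have hscale : bScale w = 2 * ((n : ℝ) - k) * A / n ^ 2 := by
    have ha : ∀ i, |a i - A / n| = a i - A / n := fun i =>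
      abs_of_pos (sub_pos.2 (halarge i))
    have hb : ∀ j, |b j - A / n| = A / n - b j := fun j => by
      rw [abs_of_nonpos (sub_nonpos.2 (hbsmall j)), neg_sub]
    rw [bScale, sum_fin_eq_head_add_tail hkn]
    simp only [hw1, hw2, hshift, ha, hb, sum_sub_distrib, hasum, hbsum, sum_const, card_univ,
      Fintype.card_fin, nsmul_eq_mul, Nat.cast_sub hkn]
    field_simp
    ring
  have hsign1 : ∀ i, bSign (a i - A / n) = 1 := fun i => if_pos (sub_pos.2 (halarge i))
  have hsign2 : ∀ j, bSign (b j - A / n) = -1 := fun j =>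
    if_neg (not_lt.2 (sub_nonpos.2 (hbsmall j)))
  have hx1' : ∀ i : Fin k, x ⟨i, by omega⟩ = c := fun i => hx1 _ i.2
  have hx2' : ∀ j : Fin (n - k), x ⟨k + j, by omega⟩ = d := fun j => hx2 _ (Nat.le_add_right _ _)
  rw [sum_fin_eq_head_add_tail hkn]
  simp only [bDeq, hw1, hw2, hshift, hscale, hsign1, hsign2, hx1', hx2', sum_const, card_univ,
    Fintype.card_fin, nsmul_eq_mul, Nat.cast_sub hkn]
  ring

theorem stmt_8 (n k : ℕ) (hk : 1 ≤ k) (hkn : 2 * k < n)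
    (A : ℝ) (hA : 0 < A)
    (a : Fin k → ℝ) (hasum : ∑ i, a i = A) (halarge : ∀ i, A / n < a i)
    (b : Fin (n - k) → ℝ) (hbsum : ∑ j, b j = 0) (hbsmall : ∀ j, b j ≤ A / n)
    (w : Fin n → ℝ)
    (hw1 : ∀ i : Fin k, w ⟨i, by omega⟩ = a i)
    (hw2 : ∀ j : Fin (n - k), w ⟨k + j, by omega⟩ = b j)
    (m : ℝ) (hm : 1 < m) (hmb : ∀ j, m * b j ≤ A / n)
    (wnew : Fin n → ℝ)
    (hwn1 : ∀ i : Fin k, wnew ⟨i, by omega⟩ = a i)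
    (hwn2 : ∀ j : Fin (n - k), wnew ⟨k + j, by omega⟩ = m * b j)
    (x : Fin n → ℝ) (hx : ∀ i, x i = 2)
    (xnew : Fin n → ℝ)
    (hxn1 : ∀ i : Fin n, (i : ℕ) < k → xnew i = 2)
    (hxn2 : ∀ i : Fin n, k ≤ (i : ℕ) → xnew i = 2 / m) :
    (∑ i, xnew i * bDeq wnew i) - (∑ i, x i * bDeq w i) =
        2 * (1 - 1 / m) * ((n : ℝ) - k) * ((n : ℝ) - 2 * k) * A / (n : ℝ) ^ 2 ∧
      0 < 2 * (1 - 1 / m) * ((n : ℝ) - k) * ((n : ℝ) - 2 * k) * A / (n : ℝ) ^ 2 := by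
  have hn : (0 : ℝ) < n := by exact_mod_cast (by omega : 0 < n)
  have hm0 : 0 < m := by linarith
  have hkn' : 2 * (k : ℝ) < n := by exact_mod_cast hkn
  constructor
  · rw [sum_mul_bDeq (by omega) (by omega) a hasum halarge (fun j => m * b j)
        (by rw [← mul_sum, hbsum, mul_zero]) hmb wnew hwn1 hwn2 xnew hxn1 hxn2,
      sum_mul_bDeq (by omega) (by omega) a hasum halarge b hbsum hbsmall w hw1 hw2 x
        (fun i _ => hx i) (fun i _ => hx i)]
    field_simp
    ring
  · have h1 : 0 < 1 - 1 / m := sub_pos.2 ((div_lt_one hm0).2 hm)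
    have h2 : 0 < (n : ℝ) - k := by linarith [(Nat.cast_nonneg k : (0 : ℝ) ≤ k)]
    have h3 : 0 < (n : ℝ) - 2 * k := by linarith
    positivity
end

section
/- Under the part-2 setup, the binarization scale of w satisfies α(w) = (1/n)·Σ_{i=1}^n |w_i − β(w)| = 2m(A − kA/n)/n = 2mA(n−k)/n². -/
open Finset

/-- A sum over `Fin n` splits into the first `k` and the last `n - k` indices. -/
theorem sum_fin_eq_sum_add_sum {M : Type*} [AddCommMonoid M] {n k : ℕ} (h : k ≤ n)
    (f : Fin n → M) :
    ∑ i, f i = ∑ i : Fin k, f ⟨i, by omega⟩ + ∑ j : Fin (n - k), f ⟨k + j, by omega⟩ := by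
  have hn : k + (n - k) = n := by omega
  rw [← Equiv.sum_comp (finCongr hn) f, Fin.sum_univ_add]
  rfl

theorem stmt_11 (n k : ℕ) (hk : 1 ≤ k) (hkn : 2 * k < n)
    (A : ℝ) (hA : 0 < A) (m : ℝ) (hm : 1 < m)
    (a : Fin k → ℝ) (hasum : ∑ i, a i = A) (halarge : ∀ i, A / n < a i)
    (b : Fin (n - k) → ℝ) (hbsum : ∑ j, b j = 0) (hbsmall : ∀ j, b j ≤ A / n)
    (w : Fin n → ℝ)
    (hw1 : ∀ i : Fin k, w ⟨i, by omega⟩ = m * a i)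
    (hw2 : ∀ j : Fin (n - k), w ⟨k + j, by omega⟩ = b j) :
    bScale w = 2 * m * (A - (k : ℝ) * A / n) / n ∧
      bScale w = 2 * m * A * ((n : ℝ) - k) / (n : ℝ) ^ 2 := by
  have hn : (0 : ℝ) < n := by exact_mod_cast (by omega : 0 < n)
  have hkn' : k ≤ n := by omega
  have hm0 : 0 < m := by linarith
  have hshift : bShift w = m * (A / n) := by
    rw [bShift, sum_fin_eq_sum_add_sum hkn']
    simp only [hw1, hw2, ← Finset.mul_sum, hasum, hbsum]
    ring
  have hfirst (i : Fin k) : |m * a i - m * (A / n)| = m * a i - m * (A / n) :=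
    abs_of_nonneg (sub_nonneg.2 (mul_le_mul_of_nonneg_left (halarge i).le hm0.le))
  have hlast (j : Fin (n - k)) : |b j - m * (A / n)| = m * (A / n) - b j := by
    rw [abs_of_nonpos, neg_sub]
    exact sub_nonpos.2 ((hbsmall j).trans (le_mul_of_one_le_left (by positivity) hm.le))
  have hscale : bScale w = 2 * m * (A - (k : ℝ) * A / n) / n := by
    rw [bScale, sum_fin_eq_sum_add_sum hkn']
    simp only [hw1, hw2, hshift, hfirst, hlast, Finset.sum_sub_distrib, ← Finset.mul_sum,
      hasum, hbsum, Finset.sum_const, Finset.card_univ, Fintype.card_fin, nsmul_eq_mul,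
      Nat.cast_sub hkn']
    field_simp
    ring
  refine ⟨hscale, hscale.trans ?_⟩
  field_simp
end

section
/- Under the part-2 setup, the dequantized vector of w takes exactly two values determined by the position: deq(w)_i = α(w) + β(w) = (3mA − 2mkA/n)/n for every position i ≤ k (the positions holding m·a_1, …, m·a_k), and deq(w)_i = −α(w) + β(w) = (mA/n)·(2k/n − 1) for every position i > k (the positions holding b_1, …, b_{n−k}). -/
open Finset

theorem Fin.sum_eq_sum_lt_add_sum_ge {n k : ℕ} (h : k ≤ n) (f : Fin n → ℝ) :
    ∑ i, f i = ∑ i : Fin k, f ⟨i, by omega⟩ + ∑ j : Fin (n - k), f ⟨k + j, by omega⟩ := by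
  rw [← Equiv.sum_comp (finCongr (Nat.add_sub_of_le h)) f, Fin.sum_univ_add]
  rfl

theorem stmt_12 (n k : ℕ) (hk : 1 ≤ k) (hkn : 2 * k < n)
    (A : ℝ) (hA : 0 < A) (m : ℝ) (hm : 1 < m)
    (a : Fin k → ℝ) (hasum : ∑ i, a i = A) (halarge : ∀ i, A / n < a i)
    (b : Fin (n - k) → ℝ) (hbsum : ∑ j, b j = 0) (hbsmall : ∀ j, b j ≤ A / n)
    (w : Fin n → ℝ)
    (hw1 : ∀ i : Fin k, w ⟨i, by omega⟩ = m * a i)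
    (hw2 : ∀ j : Fin (n - k), w ⟨k + j, by omega⟩ = b j) :
    (∀ i : Fin n, (i : ℕ) < k →
        bDeq w i = bScale w + bShift w ∧ bDeq w i = (3 * m * A - 2 * m * k * A / n) / n) ∧
      (∀ i : Fin n, k ≤ (i : ℕ) →
        bDeq w i = -bScale w + bShift w ∧ bDeq w i = (m * A / n) * (2 * (k : ℝ) / n - 1)) := by
  have hn : (0 : ℝ) < n := by
    exact_mod_cast (show 0 < n by omega)
  have hβ : bShift w = m * A / n := by
    rw [bShift, Fin.sum_eq_sum_lt_add_sum_ge (by omega : k ≤ n)]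
    simp only [hw1, hw2, hbsum, ← Finset.mul_sum, hasum]
    ring
  have hpos (i : Fin k) : 0 < m * a i - bShift w := by
    have h := mul_lt_mul_of_pos_left (halarge i) (by linarith : 0 < m)
    rw [hβ, mul_div_assoc]
    linarith
  have hneg (j : Fin (n - k)) : b j - bShift w ≤ 0 := by
    have h := mul_le_mul_of_nonneg_right hm.le (div_pos hA hn).le
    rw [hβ, mul_div_assoc]
    linarith [hbsmall j]
  have hα : bScale w = (2 * m * A - 2 * m * k * A / n) / n := by
    rw [bScale, Fin.sum_eq_sum_lt_add_sum_ge (by omega : k ≤ n)]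
    simp only [hw1, hw2, fun i => abs_of_pos (hpos i), fun j => abs_of_nonpos (hneg j)]
    simp only [Finset.sum_neg_distrib, Finset.sum_sub_distrib, hbsum, ← Finset.mul_sum, hasum,
      Finset.sum_const, Finset.card_univ, Fintype.card_fin, nsmul_eq_mul, hβ,
      Nat.cast_sub (by omega : k ≤ n)]
    field_simp
    ring
  refine ⟨fun i hi => ?_, fun i hi => ?_⟩
  · have hdeq : bDeq w i = bScale w + bShift w := by
      have hwi : 0 < w i - bShift w := by
        have h := hpos ⟨i, hi⟩
        rwa [← hw1] at h
      rw [bDeq, bSign, if_pos hwi, mul_one]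
    refine ⟨hdeq, ?_⟩
    rw [hdeq, hα, hβ]
    ring
  · have hdeq : bDeq w i = -bScale w + bShift w := by
      have hwi : w i - bShift w ≤ 0 := by
        have h := hneg ⟨i - k, by omega⟩
        rw [← hw2] at h
        simpa only [Nat.add_sub_of_le hi] using h
      rw [bDeq, bSign, if_neg hwi.not_gt, mul_neg_one]
    refine ⟨hdeq, ?_⟩
    rw [hdeq, hα, hβ]
    ring
end

section
/- (Theorem 1, case of scaling down large values.) Under the part-2 setup, let x ∈ ℝⁿ be the constant vector with every entry 1, let x_new ∈ ℝⁿ have entries m at positions i ≤ k and 1 at positions i > k, and let w_new ∈ ℝⁿ have first k entries a_1, …, a_k and last n−k entries b_1, …, b_{n−k}. Then ⟨x, deq(w)⟩ < ⟨x_new, deq(w_new)⟩ < mA = ⟨x, w⟩, and consequently the quantization error strictly decreases: |⟨x, w⟩ − ⟨x_new, deq(w_new)⟩| < |⟨x, w⟩ − ⟨x, deq(w)⟩|. -/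
open Finset

theorem sum_fin_split {n k l : ℕ} (h : n = k + l) (f : Fin n → ℝ) :
    ∑ i, f i = ∑ i : Fin k, f ⟨i, by omega⟩ + ∑ j : Fin l, f ⟨k + j, by omega⟩ := by
  subst h
  exact Fin.sum_univ_add f

theorem bSign_of_pos {t : ℝ} (h : 0 < t) : bSign t = 1 := if_pos h

theorem bSign_of_nonpos {t : ℝ} (h : t ≤ 0) : bSign t = -1 := if_neg h.not_gt

/-- If the first `k` entries of `w` sum to `S` and exceed `S / n`, while the others sum to `0` and
are at most `S / n`, then `bDeq w` takes one explicit value on each of the two blocks. -/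
theorem bDeq_of_blocks {n k l : ℕ} (h : n = k + l) (hn : 0 < n) {S : ℝ} (w : Fin n → ℝ)
    (c : Fin k → ℝ) (hcsum : ∑ i, c i = S) (hc : ∀ i, S / n < c i)
    (b : Fin l → ℝ) (hbsum : ∑ j, b j = 0) (hb : ∀ j, b j ≤ S / n)
    (hw1 : ∀ i : Fin k, w ⟨i, by omega⟩ = c i)
    (hw2 : ∀ j : Fin l, w ⟨k + j, by omega⟩ = b j) :
    (∀ i : Fin k, bDeq w ⟨i, by omega⟩ = S / n + 2 * S * l / n ^ 2) ∧
      ∀ j : Fin l, bDeq w ⟨k + j, by omega⟩ = S / n - 2 * S * l / n ^ 2 := by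
  have hn' : (n : ℝ) ≠ 0 := by positivity
  have hnkl : (n : ℝ) = k + l := by exact_mod_cast h
  have hshift : bShift w = S / n := by
    rw [bShift, sum_fin_split h]
    simp only [hw1, hw2, hcsum, hbsum]
    ring
  have hscale : bScale w = 2 * S * l / n ^ 2 := by
    have h1 : ∀ i : Fin k, |c i - S / n| = c i - S / n := fun i =>
      abs_of_pos (sub_pos.2 (hc i))
    have h2 : ∀ j : Fin l, |b j - S / n| = S / n - b j := fun j => by
      rw [abs_of_nonpos (sub_nonpos.2 (hb j)), neg_sub]
    rw [bScale, hshift, sum_fin_split h]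
    simp only [hw1, hw2, h1, h2, Finset.sum_sub_distrib, hcsum, hbsum, Finset.sum_const,
      Finset.card_univ, Fintype.card_fin, nsmul_eq_mul]
    field_simp
    rw [hnkl]
    ring
  refine ⟨fun i => ?_, fun j => ?_⟩
  · rw [bDeq, hshift, hscale, hw1, bSign_of_pos (sub_pos.2 (hc i))]
    ring
  · rw [bDeq, hshift, hscale, hw2, bSign_of_nonpos (sub_nonpos.2 (hb j))]
    ring

theorem stmt_15 (n k : ℕ) (hk : 1 ≤ k) (hkn : 2 * k < n)
    (A : ℝ) (hA : 0 < A) (m : ℝ) (hm : 1 < m)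
    (a : Fin k → ℝ) (hasum : ∑ i, a i = A) (halarge : ∀ i, A / n < a i)
    (b : Fin (n - k) → ℝ) (hbsum : ∑ j, b j = 0) (hbsmall : ∀ j, b j ≤ A / n)
    (w : Fin n → ℝ)
    (hw1 : ∀ i : Fin k, w ⟨i, by omega⟩ = m * a i)
    (hw2 : ∀ j : Fin (n - k), w ⟨k + j, by omega⟩ = b j)
    (wnew : Fin n → ℝ)
    (hwn1 : ∀ i : Fin k, wnew ⟨i, by omega⟩ = a i)
    (hwn2 : ∀ j : Fin (n - k), wnew ⟨k + j, by omega⟩ = b j)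
    (x : Fin n → ℝ) (hx : ∀ i, x i = 1)
    (xnew : Fin n → ℝ)
    (hxn1 : ∀ i : Fin n, (i : ℕ) < k → xnew i = m)
    (hxn2 : ∀ i : Fin n, k ≤ (i : ℕ) → xnew i = 1) :
    (∑ i, x i * bDeq w i) < (∑ i, xnew i * bDeq wnew i) ∧
      (∑ i, xnew i * bDeq wnew i) < m * A ∧
      (∑ i, x i * w i) = m * A ∧
      |(∑ i, x i * w i) - (∑ i, xnew i * bDeq wnew i)| <
        |(∑ i, x i * w i) - (∑ i, x i * bDeq w i)| := by
  have hnpos : 0 < n := by omega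
  have h : n = k + (n - k) := by omega
  have hn : (0 : ℝ) < n := by exact_mod_cast hnpos
  have hm0 : 0 < m := by linarith
  have hl : ((n - k : ℕ) : ℝ) = n - k := Nat.cast_sub (by omega)
  have hdiv : A / n ≤ m * A / n := by
    gcongr
    nlinarith
  obtain ⟨hd1, hd2⟩ := bDeq_of_blocks (S := m * A) h hnpos w (fun i => m * a i)
    (by rw [← Finset.mul_sum, hasum])
    (fun i => by rw [mul_div_assoc]; exact mul_lt_mul_of_pos_left (halarge i) hm0)
    b hbsum (fun j => (hbsmall j).trans hdiv) hw1 hw2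
  obtain ⟨he1, he2⟩ := bDeq_of_blocks h hnpos wnew a hasum halarge b hbsum hbsmall hwn1 hwn2
  have hxw : ∑ i, x i * w i = m * A := by
    rw [sum_fin_split h]
    simp only [hx, hw1, hw2, one_mul, ← Finset.mul_sum, hasum, hbsum, add_zero]
  set P : ℝ := A * ((n - k) * (n - 2 * k)) / n ^ 2 with hP
  have hPpos : 0 < P := by
    have h2k : (2 * k : ℝ) < n := by exact_mod_cast hkn
    have hk0 : (0 : ℝ) ≤ k := k.cast_nonneg
    have h1 : (0 : ℝ) < n - k := by linarith
    have h2 : (0 : ℝ) < n - 2 * k := by linarith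
    positivity
  have hold : ∑ i, x i * bDeq w i = m * A - 2 * m * P := by
    rw [sum_fin_split h]
    simp only [hx, hd1, hd2, one_mul, Finset.sum_const, Finset.card_univ, Fintype.card_fin,
      nsmul_eq_mul, hl, hP]
    field_simp
    ring
  have hnew : ∑ i, xnew i * bDeq wnew i = m * A - (m + 1) * P := by
    have hx1 : ∀ i : Fin k, xnew ⟨i, by omega⟩ = m := fun i => hxn1 _ i.isLt
    have hx2 : ∀ j : Fin (n - k), xnew ⟨k + j, by omega⟩ = 1 := fun j =>
      hxn2 _ (Nat.le_add_right k j)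
    rw [sum_fin_split h]
    simp only [hx1, hx2, he1, he2, one_mul, Finset.sum_const, Finset.card_univ,
      Fintype.card_fin, nsmul_eq_mul, hl, hP]
    field_simp
    ring
  have hlt : (m + 1) * P < 2 * m * P := mul_lt_mul_of_pos_right (by linarith) hPpos
  have hpos : 0 < (m + 1) * P := by positivity
  rw [hxw, hold, hnew]
  refine ⟨by linarith, by linarith, rfl, ?_⟩
  rw [sub_sub_cancel, sub_sub_cancel, abs_of_pos hpos, abs_of_pos (hpos.trans hlt)]
  exact hlt
end
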